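/- For all positive integers r and n, in ℤ[q] one has ∑_{σ ∈ D_{r,n}} q^{exc^Abs(σ)} (−1)^{cyc(σ)} = −q · [r]_q^n · [n−1]_q, where the sum is over all derangements in G_{r,n}. -/

import Mathlib

open Finset Polynomial

/-- Number of excedances of a permutation: #{i : τ(i) > i}. -/
def exc {n : ℕ} (τ : Equiv.Perm (Fin n)) : ℕ :=
  (Finset.univ.filter fun i => i < τ i).card

/-- Number of cycles of a permutation, counting fixed points as cycles. -/
def cyc {n : ℕ} (τ : Equiv.Perm (Fin n)) : ℕ :=
  Multiset.card τ.cycleType + (Finset.univ.filter fun i => τ i = i).card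

/-- Color sum of a colored permutation. -/
def csum {r n : ℕ} (z : Fin n → Fin r) : ℕ := ∑ i, (z i : ℕ)

/-- #{i : z_i = 0 and τ(i) > i}. -/
def excA {r n : ℕ} (z : Fin n → Fin r) (τ : Equiv.Perm (Fin n)) : ℕ :=
  (Finset.univ.filter fun i => (z i : ℕ) = 0 ∧ i < τ i).card

/-- Excedance number with respect to the absolute order. -/
def excAbs {r n : ℕ} (z : Fin n → Fin r) (τ : Equiv.Perm (Fin n)) : ℕ :=
  exc τ + csum z

/-- Excedance number with respect to the color order. -/
def excClr {r n : ℕ} (z : Fin n → Fin r) (τ : Equiv.Perm (Fin n)) : ℕ :=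
  r * excA z τ + csum z

/-- The zero-diagonal matrix with `q` below the diagonal and `1` above it. -/
def excMatrix {R : Type*} [CommRing R] (q : R) (n : ℕ) : Matrix (Fin n) (Fin n) R :=
  Matrix.of fun i j => if j < i then q else if i = j then 0 else 1

/-- Adding `t` to every entry of a square matrix changes its determinant affinely in `t`. -/
theorem exists_det_add_const {R : Type*} [CommRing R] {m : ℕ}
    (A : Matrix (Fin (m + 1)) (Fin (m + 1)) R) :
    ∃ d : R, ∀ t : R, (A + Matrix.of fun _ _ => t).det = A.det + t * d := by
  let B : Matrix (Fin (m + 1)) (Fin (m + 1)) R := Matrix.of fun i j => A i j - A 0 j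
  have key (t : R) : (A + Matrix.of fun _ _ => t).det =
      (B.updateRow 0 (A 0)).det + t * (B.updateRow 0 fun _ => 1).det := by
    rw [← Matrix.det_updateRow_smul, ← Matrix.det_updateRow_add]
    refine Matrix.det_eq_of_forall_row_eq_smul_add_const
      (fun i => if i = 0 then 0 else 1) 0 (by simp) fun i j => ?_
    by_cases hi : i = 0
    · subst hi
      simp
    · simp [hi, B]
      ring
  have h_zero : A.det = (B.updateRow 0 (A 0)).det := by
    have h := key 0
    rwa [zero_mul, add_zero, show A + Matrix.of (fun _ _ => (0 : R)) = A by ext; simp] at h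
  exact ⟨_, fun t => by rw [key t, h_zero]⟩

theorem sub_one_mul_det_excMatrix {R : Type*} [CommRing R] (q : R) (m : ℕ) :
    (q - 1) * (excMatrix q (m + 1)).det = q * (-1) ^ (m + 1) - (-q) ^ (m + 1) := by
  obtain ⟨d, hd⟩ := exists_det_add_const (excMatrix q (m + 1))
  have h_lower : (excMatrix q (m + 1) + Matrix.of fun _ _ => -1).det = (-1) ^ (m + 1) := by
    rw [Matrix.det_of_isLowerTriangular]
    · simp [excMatrix]
    · intro i j hij
      have hij : i < j := hij
      simp [excMatrix, hij.not_gt, hij.ne]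
  have h_upper : (excMatrix q (m + 1) + Matrix.of fun _ _ => -q).det = (-q) ^ (m + 1) := by
    rw [Matrix.det_of_isUpperTriangular]
    · simp [excMatrix]
    · intro i j hij
      have hij : j < i := hij
      simp [excMatrix, hij]
  rw [hd] at h_lower h_upper
  linear_combination q * h_lower - h_upper

theorem neg_one_pow_cyc {R : Type*} [CommRing R] {n : ℕ} {τ : Equiv.Perm (Fin n)}
    (hτ : ∀ i, τ i ≠ i) :
    (-1 : R) ^ cyc τ = (-1) ^ n * ((Equiv.Perm.sign τ : ℤ) : R) := by
  have h_support : τ.support = Finset.univ := by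
    ext i
    simp [hτ i]
  rw [Equiv.Perm.sign_of_cycleType, Equiv.Perm.sum_cycleType, h_support, cyc]
  simp only [hτ, Finset.filter_false, Finset.card_empty, add_zero, Finset.card_univ,
    Fintype.card_fin]
  push_cast
  rw [pow_add, ← mul_assoc, ← mul_pow]
  simp

theorem prod_excMatrix {R : Type*} [CommRing R] (q : R) {n : ℕ} (τ : Equiv.Perm (Fin n)) :
    ∏ i, excMatrix q n (τ i) i = if ∀ i, τ i ≠ i then q ^ exc τ else 0 := by
  split_ifs with hτ
  · simp [excMatrix, hτ, exc, Finset.prod_ite]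
  · push Not at hτ
    obtain ⟨i, hi⟩ := hτ
    exact Finset.prod_eq_zero (Finset.mem_univ i) (by simp [excMatrix, hi])

theorem sum_derangements_pow_exc {R : Type*} [CommRing R] (q : R) (n : ℕ) :
    ∑ τ : Equiv.Perm (Fin n) with ∀ i, τ i ≠ i, q ^ exc τ * (-1) ^ cyc τ =
      (-1) ^ n * (excMatrix q n).det := by
  rw [Matrix.det_apply', Finset.mul_sum, Finset.sum_filter]
  refine Finset.sum_congr rfl fun τ _ => ?_
  rw [prod_excMatrix]
  split_ifs with hτ
  · rw [neg_one_pow_cyc hτ]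
    ring
  · simp

theorem sum_pow_csum {R : Type*} [CommRing R] (q : R) (r n : ℕ) :
    ∑ z : Fin n → Fin r, q ^ csum z = (∑ i ∈ Finset.range r, q ^ i) ^ n := by
  simp only [csum, ← Finset.prod_pow_eq_pow_sum]
  rw [← Fin.sum_univ_eq_sum_range, Finset.sum_pow']
  simp

theorem stmt4 (r n : ℕ) (hr : 0 < r) (hn : 0 < n) :
    ∑ σ ∈ Finset.univ.filter
        (fun σ : (Fin n → Fin r) × Equiv.Perm (Fin n) => ∀ i, σ.2 i ≠ i),
      (X : Polynomial ℤ) ^ excAbs σ.1 σ.2 * (-1) ^ cyc σ.2 =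
    -(X : Polynomial ℤ) * (∑ i ∈ Finset.range r, (X : Polynomial ℤ) ^ i) ^ n *
      ∑ i ∈ Finset.range (n - 1), (X : Polynomial ℤ) ^ i := by
  obtain ⟨m, rfl⟩ : ∃ m, n = m + 1 := ⟨n - 1, by omega⟩
  have h_derangements :
      ∑ τ : Equiv.Perm (Fin (m + 1)) with ∀ i, τ i ≠ i,
        (X : Polynomial ℤ) ^ exc τ * (-1) ^ cyc τ = -X * ∑ i ∈ Finset.range m, X ^ i := by
    have h_ne : (X - 1 : Polynomial ℤ) ≠ 0 := Polynomial.X_sub_C_ne_zero 1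
    apply mul_left_cancel₀ h_ne
    have h_sign : ((-1 : Polynomial ℤ) ^ (m + 1)) * (-1) ^ (m + 1) = 1 := by
      rw [← mul_pow]
      simp
    have h_det := sub_one_mul_det_excMatrix (X : Polynomial ℤ) m
    rw [neg_pow (X : Polynomial ℤ)] at h_det
    rw [sum_derangements_pow_exc]
    linear_combination (-1) ^ (m + 1) * h_det + (X - X ^ (m + 1)) * h_sign +
      X * mul_geom_sum (X : Polynomial ℤ) m
  have h_product : (Finset.univ.filter
      fun σ : (Fin (m + 1) → Fin r) × Equiv.Perm (Fin (m + 1)) => ∀ i, σ.2 i ≠ i) =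
      Finset.univ ×ˢ Finset.univ.filter fun τ : Equiv.Perm (Fin (m + 1)) => ∀ i, τ i ≠ i := by
    ext σ
    simp
  calc
    _ = (∑ z : Fin (m + 1) → Fin r, (X : Polynomial ℤ) ^ csum z) *
        ∑ τ : Equiv.Perm (Fin (m + 1)) with ∀ i, τ i ≠ i, X ^ exc τ * (-1) ^ cyc τ := by
      rw [h_product, Finset.sum_product, Finset.sum_mul_sum]
      refine Finset.sum_congr rfl fun z _ => Finset.sum_congr rfl fun τ _ => ?_
      rw [excAbs]
      ring
    _ = _ := by
      rw [sum_pow_csum, h_derangements, Nat.add_sub_cancel]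
      ring
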